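/- arXiv:2601.19682 — 3 statements merged into one kernel-verified Lean document; each statement's English description precedes it below -/
import Mathlib

section
/- Let f : [0,1] → ℝ be continuous and let u : [0,1] → ℝ be continuous on [0,1], continuously differentiable on [0,1], twice differentiable on (0,1) with u″(x) = −f(x) for all x ∈ (0,1), and u(0) = u(1) = 0. Let ū : [0,1] → ℝ be continuously differentiable on [0,1] and let c ≥ 0 be a real number such that ū(0) ≥ c, ū(1) ≥ c, and for every s ∈ (0,1): (1/s)·∫₀^s ū′(x) dx − (1/(1−s))·∫_s^1 ū′(x) dx + c/(s(1−s)) ≥ ∫₀¹ f(x)·φ_s(x) dx, where φ_s is the tent function. Then u(x) ≤ ū(x) for every x ∈ [0,1]. -/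
open intervalIntegral

/-- one-dimensional comparison theorem for Green-representable
super-solutions: if `ū` is `C¹` on `[0,1]`, `ū(0) ≥ c`, `ū(1) ≥ c` for some `c ≥ 0`,
and for every `s ∈ (0,1)` the super-solution inequality
`∫₀¹ ū'·φ_s' + c/(s(1-s)) ≥ ∫₀¹ f·φ_s` holds with the tent function `φ_s`,
then `u ≤ ū` on `[0,1]` for the solution `u` of `-u'' = f`, `u(0) = u(1) = 0`. -/
theorem stmt_10 (f : ℝ → ℝ) (hf : ContinuousOn f (Set.Icc (0:ℝ) 1))
    (u u' : ℝ → ℝ)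
    (hu : ∀ x ∈ Set.Icc (0:ℝ) 1, HasDerivAt u (u' x) x)
    (hu'c : ContinuousOn u' (Set.Icc (0:ℝ) 1))
    (hu'' : ∀ x ∈ Set.Ioo (0:ℝ) 1, HasDerivAt u' (-(f x)) x)
    (hu0 : u 0 = 0) (hu1 : u 1 = 0)
    (ubar ubar' : ℝ → ℝ)
    (hubar : ∀ x ∈ Set.Icc (0:ℝ) 1, HasDerivAt ubar (ubar' x) x)
    (hubar'c : ContinuousOn ubar' (Set.Icc (0:ℝ) 1))
    (c : ℝ) (hc : 0 ≤ c)
    (hb0 : c ≤ ubar 0) (hb1 : c ≤ ubar 1)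
    (hsuper : ∀ s ∈ Set.Ioo (0:ℝ) 1,
      (∫ x in (0:ℝ)..1, f x * (if x ≤ s then x / s else (1 - x) / (1 - s)))
        ≤ (1 / s) * (∫ x in (0:ℝ)..s, ubar' x)
          - (1 / (1 - s)) * (∫ x in s..(1:ℝ), ubar' x)
          + c / (s * (1 - s))) :
    ∀ x ∈ Set.Icc (0:ℝ) 1, u x ≤ ubar x := by
  intro s hs
  rcases eq_or_lt_of_le hs.1 with h0 | h0
  · rw [← h0, hu0]; linarith
  rcases eq_or_lt_of_le hs.2 with h1 | h1
  · rw [h1, hu1]; linarith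
  have key := hsuper s ⟨h0, h1⟩
  have hs1 : 0 < 1 - s := by linarith
  have sub0 : Set.Icc 0 s ⊆ Set.Icc (0:ℝ) 1 := Set.Icc_subset_Icc le_rfl h1.le
  have sub1 : Set.Icc s 1 ⊆ Set.Icc (0:ℝ) 1 := Set.Icc_subset_Icc h0.le le_rfl
  have cu : ContinuousOn u (Set.Icc (0:ℝ) 1) :=
    fun x hx => (hu x hx).continuousAt.continuousWithinAt
  have cb : ContinuousOn ubar (Set.Icc (0:ℝ) 1) :=
    fun x hx => (hubar x hx).continuousAt.continuousWithinAt
  have b0 : (∫ x in (0:ℝ)..s, ubar' x) = ubar s - ubar 0 :=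
    integral_eq_sub_of_hasDerivAt_of_le h0.le (cb.mono sub0)
      (fun x hx => hubar x (sub0 (Set.Ioo_subset_Icc_self hx)))
      ((hubar'c.mono sub0).intervalIntegrable_of_Icc h0.le)
  have b1 : (∫ x in s..(1:ℝ), ubar' x) = ubar 1 - ubar s :=
    integral_eq_sub_of_hasDerivAt_of_le h1.le (cb.mono sub1)
      (fun x hx => hubar x (sub1 (Set.Ioo_subset_Icc_self hx)))
      ((hubar'c.mono sub1).intervalIntegrable_of_Icc h1.le)
  have c0 : ContinuousOn (fun x => f x * (x / s)) (Set.Icc 0 s) :=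
    (hf.mono sub0).mul (by fun_prop)
  have c1 : ContinuousOn (fun x => f x * ((1 - x) / (1 - s))) (Set.Icc s 1) :=
    (hf.mono sub1).mul (by fun_prop)
  have i0 := c0.intervalIntegrable_of_Icc (μ := MeasureTheory.volume) h0.le
  have i1 := c1.intervalIntegrable_of_Icc (μ := MeasureTheory.volume) h1.le
  have a0 : (∫ x in (0:ℝ)..s, f x * (x / s)) = (u s - s * u' s) / s := by
    rw [integral_eq_sub_of_hasDerivAt_of_le (f := fun x => (u x - x * u' x) / s) h0.le
      (((cu.sub (continuousOn_id.mul hu'c)).div_const s).mono sub0) _ i0]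
    · simp [hu0]
    · intro x hx
      have hx' : x ∈ Set.Ioo (0:ℝ) 1 := ⟨hx.1, hx.2.trans h1⟩
      refine HasDerivAt.congr_deriv (((hu x (Set.Ioo_subset_Icc_self hx')).sub
        ((hasDerivAt_id' x).mul (hu'' x hx'))).div_const s) ?_
      ring
  have a1 : (∫ x in s..(1:ℝ), f x * ((1 - x) / (1 - s)))
      = ((1 - s) * u' s + u s) / (1 - s) := by
    rw [integral_eq_sub_of_hasDerivAt_of_le
      (f := fun x => (-u x - (1 - x) * u' x) / (1 - s)) h1.le
      (((cu.neg.sub ((continuousOn_const.sub continuousOn_id).mul hu'c)).div_const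
        (1 - s)).mono sub1) _ i1]
    · simp only [hu1]; ring
    · intro x hx
      have hx' : x ∈ Set.Ioo (0:ℝ) 1 := ⟨h0.trans hx.1, hx.2⟩
      refine HasDerivAt.congr_deriv (((hu x (Set.Ioo_subset_Icc_self hx')).neg.sub
        (((hasDerivAt_id' x).const_sub 1).mul (hu'' x hx'))).div_const (1 - s)) ?_
      ring
  have e0 : Set.EqOn (fun x => f x * (x / s))
      (fun x => f x * (if x ≤ s then x / s else (1 - x) / (1 - s))) (Set.uIoc 0 s) := by
    intro x hx
    rw [Set.uIoc_of_le h0.le] at hx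
    simp [hx.2]
  have e1 : Set.EqOn (fun x => f x * ((1 - x) / (1 - s)))
      (fun x => f x * (if x ≤ s then x / s else (1 - x) / (1 - s))) (Set.uIoc s 1) := by
    intro x hx
    rw [Set.uIoc_of_le h1.le] at hx
    simp [not_le.mpr hx.1]
  rw [← integral_add_adjacent_intervals (i0.congr e0) (i1.congr e1),
    ← integral_congr_ae (Filter.Eventually.of_forall e0), ← integral_congr_ae (Filter.Eventually.of_forall e1), a0, a1, b0, b1] at key
  have hp : 0 < s * (1 - s) := mul_pos h0 hs1
  have k2 := mul_le_mul_of_nonneg_right key hp.le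
  have l : ((u s - s * u' s) / s + ((1 - s) * u' s + u s) / (1 - s)) * (s * (1 - s)) = u s := by
    field_simp; ring
  have r : (1 / s * (ubar s - ubar 0) - 1 / (1 - s) * (ubar 1 - ubar s) + c / (s * (1 - s)))
      * (s * (1 - s)) = ubar s - (1 - s) * ubar 0 - s * ubar 1 + c := by
    field_simp; ring
  rw [l, r] at k2
  nlinarith [mul_le_mul_of_nonneg_left hb0 hs1.le, mul_le_mul_of_nonneg_left hb1 h0.le]
end

section
/- Let f : [0,1] → ℝ be continuous and let u : [0,1] → ℝ be continuous on [0,1], continuously differentiable on [0,1], twice differentiable on (0,1) with u″(x) = −f(x) for all x ∈ (0,1), and u(0) = u(1) = 0. Let u̲ : [0,1] → ℝ be continuously differentiable on [0,1] and let c ≥ 0 be a real number such that u̲(0) ≤ −c, u̲(1) ≤ −c, and for every s ∈ (0,1): (1/s)·∫₀^s u̲′(x) dx − (1/(1−s))·∫_s^1 u̲′(x) dx − c/(s(1−s)) ≤ ∫₀¹ f(x)·φ_s(x) dx, where φ_s is the tent function. Then u̲(x) ≤ u(x) for every x ∈ [0,1]. -/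
open intervalIntegral

/-- one-dimensional comparison theorem for Green-representable
sub-solutions: if `u̲` is `C¹` on `[0,1]`, `u̲(0) ≤ -c`, `u̲(1) ≤ -c` for some `c ≥ 0`,
and for every `s ∈ (0,1)` the sub-solution inequality
`∫₀¹ u̲'·φ_s' - c/(s(1-s)) ≤ ∫₀¹ f·φ_s` holds with the tent function `φ_s`,
then `u̲ ≤ u` on `[0,1]` for the solution `u` of `-u'' = f`, `u(0) = u(1) = 0`. -/
theorem stmt_11 (f : ℝ → ℝ) (hf : ContinuousOn f (Set.Icc (0:ℝ) 1))
    (u u' : ℝ → ℝ)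
    (hu : ∀ x ∈ Set.Icc (0:ℝ) 1, HasDerivAt u (u' x) x)
    (hu'c : ContinuousOn u' (Set.Icc (0:ℝ) 1))
    (hu'' : ∀ x ∈ Set.Ioo (0:ℝ) 1, HasDerivAt u' (-(f x)) x)
    (hu0 : u 0 = 0) (hu1 : u 1 = 0)
    (usub usub' : ℝ → ℝ)
    (husub : ∀ x ∈ Set.Icc (0:ℝ) 1, HasDerivAt usub (usub' x) x)
    (husub'c : ContinuousOn usub' (Set.Icc (0:ℝ) 1))
    (c : ℝ) (hc : 0 ≤ c)
    (hb0 : usub 0 ≤ -c) (hb1 : usub 1 ≤ -c)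
    (hsub : ∀ s ∈ Set.Ioo (0:ℝ) 1,
      (1 / s) * (∫ x in (0:ℝ)..s, usub' x)
        - (1 / (1 - s)) * (∫ x in s..(1:ℝ), usub' x)
        - c / (s * (1 - s))
      ≤ ∫ x in (0:ℝ)..1, f x * (if x ≤ s then x / s else (1 - x) / (1 - s))) :
    ∀ x ∈ Set.Icc (0:ℝ) 1, usub x ≤ u x := by
  intro s hs
  rcases eq_or_lt_of_le hs.1 with h0 | h0
  · rw [← h0, hu0]; linarith
  rcases eq_or_lt_of_le hs.2 with h1 | h1
  · rw [h1, hu1]; linarith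
  have h1s : 0 < 1 - s := by linarith
  have key := hsub s ⟨h0, h1⟩
  have sub1 : Set.Icc 0 s ⊆ Set.Icc (0:ℝ) 1 := Set.Icc_subset_Icc_right h1.le
  have sub2 : Set.Icc s 1 ⊆ Set.Icc (0:ℝ) 1 := Set.Icc_subset_Icc_left h0.le
  have huc : ContinuousOn u (Set.Icc (0:ℝ) 1) :=
    fun x hx => (hu x hx).continuousAt.continuousWithinAt
  have e1 : ∫ x in (0:ℝ)..s, usub' x = usub s - usub 0 := by
    apply integral_eq_sub_of_hasDerivAt
    · intro x hx
      rw [Set.uIcc_of_le h0.le] at hx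
      exact husub x (sub1 hx)
    · exact (husub'c.mono sub1).intervalIntegrable_of_Icc h0.le
  have e2 : ∫ x in s..(1:ℝ), usub' x = usub 1 - usub s := by
    apply integral_eq_sub_of_hasDerivAt
    · intro x hx
      rw [Set.uIcc_of_le h1.le] at hx
      exact husub x (sub2 hx)
    · exact (husub'c.mono sub2).intervalIntegrable_of_Icc h1.le
  have i1 : IntervalIntegrable (fun x => f x * (x / s)) MeasureTheory.volume 0 s :=
    ((hf.mono sub1).mul (by fun_prop)).intervalIntegrable_of_Icc h0.le
  have i2 : IntervalIntegrable (fun x => f x * ((1 - x) / (1 - s))) MeasureTheory.volume s 1 :=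
    ((hf.mono sub2).mul (by fun_prop)).intervalIntegrable_of_Icc h1.le
  have e3 : ∫ x in (0:ℝ)..s, f x * (x / s) = (u s - s * u' s) / s - (u 0 - 0 * u' 0) / s := by
    apply integral_eq_sub_of_hasDerivAt_of_le h0.le (f := fun x => (u x - x * u' x) / s)
    · exact ((huc.sub (continuousOn_id.mul hu'c)).div_const s).mono sub1
    · intro x hx
      have hx' : x ∈ Set.Ioo (0:ℝ) 1 := ⟨hx.1, hx.2.trans h1⟩
      refine (((hu x ⟨hx'.1.le, hx'.2.le⟩).sub ((hasDerivAt_id x).mul (hu'' x hx'))).div_const s).congr_deriv ?_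
      simp only [id]; ring
    · exact i1
  have e4 : ∫ x in s..(1:ℝ), f x * ((1 - x) / (1 - s))
      = (-u 1 - (1 - 1) * u' 1) / (1 - s) - (-u s - (1 - s) * u' s) / (1 - s) := by
    apply integral_eq_sub_of_hasDerivAt_of_le h1.le
      (f := fun x => (-u x - (1 - x) * u' x) / (1 - s))
    · exact ((huc.neg.sub ((continuousOn_const.sub continuousOn_id).mul hu'c)).div_const _).mono sub2
    · intro x hx
      have hx' : x ∈ Set.Ioo (0:ℝ) 1 := ⟨h0.trans hx.1, hx.2⟩
      refine (((hu x ⟨hx'.1.le, hx'.2.le⟩).neg.sub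
        (((hasDerivAt_id x).const_sub 1).mul (hu'' x hx'))).div_const (1 - s)).congr_deriv ?_
      simp only [id]; ring
    · exact i2
  have c1 : Set.EqOn (fun x => f x * (x / s))
      (fun x => f x * (if x ≤ s then x / s else (1 - x) / (1 - s))) (Set.uIoc 0 s) := by
    intro x hx
    rw [Set.uIoc_of_le h0.le] at hx
    simp [hx.2]
  have c2 : Set.EqOn (fun x => f x * ((1 - x) / (1 - s)))
      (fun x => f x * (if x ≤ s then x / s else (1 - x) / (1 - s))) (Set.uIoc s 1) := by
    intro x hx
    rw [Set.uIoc_of_le h1.le] at hx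
    simp [not_le.mpr hx.1]
  have e5 : ∫ x in (0:ℝ)..1, f x * (if x ≤ s then x / s else (1 - x) / (1 - s))
      = (∫ x in (0:ℝ)..s, f x * (x / s)) + ∫ x in s..(1:ℝ), f x * ((1 - x) / (1 - s)) := by
    rw [← integral_add_adjacent_intervals (i1.congr c1) (i2.congr c2)]
    congr 1
    · exact (integral_congr_ae (Filter.Eventually.of_forall c1)).symm
    · exact (integral_congr_ae (Filter.Eventually.of_forall c2)).symm
  rw [e5, e3, e4, e1, e2, hu0, hu1] at key
  have k2 := mul_le_mul_of_nonneg_left key (mul_pos h0 h1s).le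
  have l1 : s * (1 - s) * (1 / s * (usub s - usub 0) - 1 / (1 - s) * (usub 1 - usub s)
      - c / (s * (1 - s))) = usub s - (1 - s) * usub 0 - s * usub 1 - c := by
    field_simp; ring
  have l2 : s * (1 - s) * ((u s - s * u' s) / s - (0 - 0 * u' 0) / s
      + ((-0 - (1 - 1) * u' 1) / (1 - s) - (-u s - (1 - s) * u' s) / (1 - s))) = u s := by
    field_simp; ring
  rw [l1, l2] at k2
  nlinarith [mul_le_mul_of_nonneg_left hb0 h1s.le, mul_le_mul_of_nonneg_left hb1 h0.le]
end

section
/- Let a > 0 and b > 0 be real numbers, let T := {(x,y) ∈ ℝ² : 0 < a·y < b·x < a·b} be the open triangle with vertices (0,0), (a,0), (a,b), and let f : ℝ² → ℝ be continuous on the closure of T. Then the (x,y) ↦ f(x,y)·log(x² + y²) is Lebesgue integrable on T and ∫_T f(x,y)·log(x² + y²) d(x,y) = ∫₀^a 2·u·log u · (∫₀^{b/a} f(u, k·u) dk) du + ∫₀^a ∫₀^{b/a} u·f(u, k·u)·log(1 + k²) dk du. -/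
open MeasureTheory intervalIntegral

/-- splitting of the singular integral with logarithmic potential over the
triangle `T = {0 < a y < b x < a b}` via the change of variables `x = u`, `y = k u`:
`∫_T f log(x²+y²) = ∫₀^a 2 u log u (∫₀^{b/a} f(u,ku) dk) du
  + ∫₀^a ∫₀^{b/a} u f(u,ku) log(1+k²) dk du`,
and the integrand is Lebesgue integrable on `T`. -/
theorem stmt_18 (a b : ℝ) (ha : 0 < a) (hb : 0 < b)
    (f : ℝ × ℝ → ℝ)
    (hf : ContinuousOn f
      (closure {p : ℝ × ℝ | 0 < a * p.2 ∧ a * p.2 < b * p.1 ∧ b * p.1 < a * b})) :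
    IntegrableOn (fun p : ℝ × ℝ => f p * Real.log (p.1 ^ 2 + p.2 ^ 2))
      {p : ℝ × ℝ | 0 < a * p.2 ∧ a * p.2 < b * p.1 ∧ b * p.1 < a * b} volume ∧
    (∫ p in {p : ℝ × ℝ | 0 < a * p.2 ∧ a * p.2 < b * p.1 ∧ b * p.1 < a * b},
        f p * Real.log (p.1 ^ 2 + p.2 ^ 2))
      = (∫ u in (0:ℝ)..a, 2 * u * Real.log u * ∫ k in (0:ℝ)..(b/a), f (u, k * u))
        + ∫ u in (0:ℝ)..a, ∫ k in (0:ℝ)..(b/a),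
            u * f (u, k * u) * Real.log (1 + k ^ 2) := by
  set T := {p : ℝ × ℝ | 0 < a * p.2 ∧ a * p.2 < b * p.1 ∧ b * p.1 < a * b} with hT
  have hc : 0 < b / a := div_pos hb ha
  set c := b / a with hcdef
  have hbc : b = a * c := by rw [hcdef]; field_simp
  set φ : ℝ × ℝ → ℝ × ℝ := fun q => (q.1, q.2 * q.1) with hφ
  set φ' : ℝ × ℝ → (ℝ × ℝ →L[ℝ] ℝ × ℝ) := fun q =>
    LinearMap.toContinuousLinearMap (Matrix.toLin (Module.Basis.finTwoProd ℝ)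
      (Module.Basis.finTwoProd ℝ) !![1, 0; q.2, q.1]) with hφ'
  set R : Set (ℝ × ℝ) := Set.Ioo 0 a ×ˢ Set.Ioo 0 c with hR
  have hRm : MeasurableSet R := measurableSet_Ioo.prod measurableSet_Ioo
  have hφcont : Continuous φ := by rw [hφ]; fun_prop
  have hder : ∀ q ∈ R, HasFDerivWithinAt φ (φ' q) R q := by
    intro q _
    apply HasFDerivAt.hasFDerivWithinAt
    rw [hφ']
    simp only [Matrix.toLin_finTwoProd_toContinuousLinearMap]
    have e1 : HasFDerivAt (fun q : ℝ × ℝ => q.1) (ContinuousLinearMap.fst ℝ ℝ ℝ) q :=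
      hasFDerivAt_fst
    have e2 : HasFDerivAt (fun q : ℝ × ℝ => q.2) (ContinuousLinearMap.snd ℝ ℝ ℝ) q :=
      hasFDerivAt_snd
    have e3 := e1.prodMk (e2.mul e1)
    convert! e3 using 2 <;> simp
  have hdet : ∀ q, (φ' q).det = q.1 := by
    intro q
    simp [hφ', ContinuousLinearMap.det, Matrix.det_fin_two_of]
  have hinj : Set.InjOn φ R := by
    rintro ⟨u, k⟩ ⟨hu, hk⟩ ⟨v, l⟩ ⟨hv, hl⟩ h
    simp only [hφ, Prod.mk.injEq] at h
    obtain ⟨rfl, h⟩ := h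
    have := mul_right_cancel₀ hu.1.ne' h
    simp [this]
  have himg : φ '' R = T := by
    ext ⟨x, y⟩
    constructor
    · rintro ⟨⟨u, k⟩, ⟨⟨hu, hua⟩, ⟨hk, hkc⟩⟩, h⟩
      simp only [hφ, Prod.mk.injEq] at h hu hua hk hkc
      obtain ⟨rfl, rfl⟩ := h
      refine ⟨by positivity, ?_, ?_⟩
      · show a * (k * u) < b * u
        rw [hbc, mul_assoc]
        gcongr
      · show b * u < a * b
        rw [mul_comm a b]; gcongr
    · rintro ⟨h1, h2, h3⟩
      simp only at h1 h2 h3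
      have hx : 0 < x := (mul_pos_iff_of_pos_left hb).1 (h1.trans h2)
      have hy : 0 < y := (mul_pos_iff_of_pos_left ha).1 h1
      refine ⟨(x, y / x), ⟨⟨hx, ?_⟩, ⟨div_pos hy hx, ?_⟩⟩, ?_⟩
      · show x < a
        rw [mul_comm a b] at h3
        exact lt_of_mul_lt_mul_left h3 hb.le
      · show y / x < c
        rw [hcdef, div_lt_div_iff₀ hx ha]; linarith
      · simp only [hφ, Prod.mk.injEq, true_and]; field_simp
  set K : Set (ℝ × ℝ) := Set.Icc 0 a ×ˢ Set.Icc 0 c with hK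
  have hKc : IsCompact K := isCompact_Icc.prod isCompact_Icc
  have hRK : R ⊆ K := Set.prod_mono Set.Ioo_subset_Icc_self Set.Ioo_subset_Icc_self
  have hKcl : K = closure R := by
    rw [hR, closure_prod_eq, closure_Ioo ha.ne, closure_Ioo hc.ne]
  have hg : ContinuousOn (fun q => f (φ q)) K := by
    apply hf.comp hφcont.continuousOn
    intro q hq
    rw [hKcl] at hq
    rw [← himg]
    exact image_closure_subset_closure_image hφcont ⟨q, hq, rfl⟩
  set F1 : ℝ × ℝ → ℝ := fun q => 2 * q.1 * Real.log q.1 * f (φ q) with hF1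
  set F2 : ℝ × ℝ → ℝ := fun q => q.1 * f (φ q) * Real.log (1 + q.2 ^ 2) with hF2
  have hF1i : IntegrableOn F1 R volume := by
    refine IntegrableOn.mono_set (ContinuousOn.integrableOn_compact hKc ?_) hRK
    refine ContinuousOn.mul ?_ hg
    have : Continuous fun q : ℝ × ℝ => 2 * (q.1 * Real.log q.1) :=
      continuous_const.mul (Real.continuous_mul_log.comp continuous_fst)
    simpa only [mul_assoc] using this.continuousOn
  have hF2i : IntegrableOn F2 R volume := by
    refine IntegrableOn.mono_set (ContinuousOn.integrableOn_compact hKc ?_) hRK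
    refine ContinuousOn.mul (continuousOn_fst.mul hg) ?_
    apply Continuous.continuousOn
    apply Continuous.log (by fun_prop)
    intro q; positivity
  have heq : Set.EqOn (fun q => |(φ' q).det| • (f (φ q) * Real.log ((φ q).1 ^ 2 + (φ q).2 ^ 2)))
      (F1 + F2) R := by
    rintro ⟨u, k⟩ ⟨⟨hu, _⟩, _⟩
    simp only at hu
    have hl : Real.log (u ^ 2 + (k * u) ^ 2) = 2 * Real.log u + Real.log (1 + k ^ 2) := by
      rw [show u ^ 2 + (k * u) ^ 2 = u ^ 2 * (1 + k ^ 2) by ring,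
        Real.log_mul (by positivity) (by positivity), Real.log_pow]
      norm_num
    simp only [hdet, hF1, hF2, Pi.add_apply, smul_eq_mul, abs_of_pos hu]
    simp only [hφ, hl]
    ring
  constructor
  · rw [← himg, integrableOn_image_iff_integrableOn_abs_det_fderiv_smul volume hRm hder hinj]
    exact (integrableOn_congr_fun heq hRm).2 (hF1i.add hF2i)
  · rw [← himg, integral_image_eq_integral_abs_det_fderiv_smul volume hRm hder hinj,
      setIntegral_congr_fun hRm heq, integral_add' hF1i hF2i]
    rw [Measure.volume_eq_prod] at hF1i hF2i ⊢
    rw [hR, setIntegral_prod _ hF1i, setIntegral_prod _ hF2i]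
    simp only [integral_of_le ha.le, integral_of_le hc.le, integral_Ioc_eq_integral_Ioo]
    simp only [hF1, hF2, hφ, MeasureTheory.integral_const_mul]
end
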